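/- arXiv:2409.12542 — 2 statements merged into one kernel-verified Lean document; each statement's English description precedes it below -/
import Mathlib

section
/- For every perfect matching M of {0,…,5}, exactly 4 of the 10 singular points of the Segre primal X_0 lie on the plane ℙ(P_M). -/
/-- The vector with entries `1` and `-1` prescribed by a Boolean function. -/
def signVector {ι : Type*} (b : ι → Bool) (i : ι) : ℂ := if b i then 1 else -1

lemma signVector_sq {ι : Type*} (b : ι → Bool) (i : ι) : signVector b i ^ 2 = 1 := by
  unfold signVector
  split_ifs <;> norm_num

lemma signVector_ne_zero {ι : Type*} [Nonempty ι] (b : ι → Bool) : signVector b ≠ 0 := by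
  intro h
  have := signVector_sq b (Classical.arbitrary ι)
  simp [h] at this

lemma signVector_injective {ι : Type*} : Function.Injective (signVector (ι := ι)) := by
  intro b c h
  funext i
  have hi := congrFun h i
  unfold signVector at hi
  cases hb : b i <;> cases hc : c i <;> simp_all [eq_neg_iff_add_eq_zero, neg_eq_iff_add_eq_zero]

lemma signVector_add_eq_zero_iff {ι : Type*} (b : ι → Bool) (i j : ι) :
    signVector b i + signVector b j = 0 ↔ b j = !b i := by
  unfold signVector
  cases b i <;> cases b j <;> norm_num

/-- A function that is odd under a permutation has vanishing sum. -/
lemma Fintype.sum_eq_zero_of_perm_odd {ι : Type*} [Fintype ι] (σ : Equiv.Perm ι) (f : ι → ℂ)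
    (h : ∀ i, f (σ i) = -f i) : ∑ i, f i = 0 := by
  have h' := Equiv.sum_comp σ f
  simp only [h, Finset.sum_neg_distrib] at h'
  exact self_eq_neg.mp h'.symm

/-- A fixed-point-free involution of `Fin 6` admits four odd sign functions that are positive
at `0`. -/
lemma card_odd_signs (σ : Equiv.Perm (Fin 6)) (hfix : ∀ i, σ i ≠ i) (hinv : ∀ i, σ (σ i) = i) :
    (Finset.univ.filter fun b : Fin 6 → Bool => b 0 = true ∧ ∀ i, b (σ i) = !b i).card = 4 := by
  revert σ
  decide +kernel

theorem stmt_4 (σ : Equiv.Perm (Fin 6)) (hfix : ∀ i, σ i ≠ i) (hinv : ∀ i, σ (σ i) = i) :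
    {P : Projectivization ℂ (Fin 6 → ℂ) | ∃ x : Fin 6 → ℂ, ∃ hx : x ≠ 0,
      P = Projectivization.mk ℂ x hx ∧
      (∑ i, x i = 0 ∧ ∑ i, x i ^ 3 = 0 ∧ ∀ i j, x i ^ 2 = x j ^ 2) ∧
      (∀ i, x i + x (σ i) = 0)}.ncard = 4 := by
  rw [← card_odd_signs σ hfix hinv, ← Set.ncard_coe_finset]
  symm
  refine Set.ncard_congr
    (fun b _ => Projectivization.mk ℂ (signVector b) (signVector_ne_zero b)) ?_ ?_ ?_
  · intro b hb
    simp only [Finset.coe_filter, Finset.mem_univ, true_and, Set.mem_ofPred_eq] at hb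
    have hodd : ∀ i, signVector b i + signVector b (σ i) = 0 := fun i =>
      (signVector_add_eq_zero_iff b i (σ i)).mpr (hb.2 i)
    have hneg : ∀ i, signVector b (σ i) = -signVector b i := fun i =>
      eq_neg_of_add_eq_zero_right (hodd i)
    refine ⟨signVector b, signVector_ne_zero b, rfl, ⟨?_, ?_, ?_⟩, hodd⟩
    · exact Fintype.sum_eq_zero_of_perm_odd σ _ hneg
    · exact Fintype.sum_eq_zero_of_perm_odd σ (fun i => signVector b i ^ 3) fun i => by
        simp only [hneg i]
        ring
    · intro i j
      rw [signVector_sq, signVector_sq]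
  · intro b c hb hc h
    simp only [Finset.coe_filter, Finset.mem_univ, true_and, Set.mem_ofPred_eq] at hb hc
    obtain ⟨a, ha⟩ := (Projectivization.mk_eq_mk_iff' ℂ _ _ _ _).mp h
    have h0 := congrFun ha 0
    have ha1 : a = 1 := by simpa [signVector, hb.1, hc.1] using h0
    rw [ha1, one_smul] at ha
    exact signVector_injective ha.symm
  · rintro P ⟨x, hx, rfl, ⟨-, -, hsq⟩, hodd⟩
    have hx0 : x 0 ≠ 0 := fun h0 => hx <| funext fun i => by
      have := hsq i 0
      simpa [h0] using this
    classical
    let b : Fin 6 → Bool := fun i => decide (x i = x 0)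
    have hb : x 0 • signVector b = x := by
      funext i
      rcases sq_eq_sq_iff_eq_or_eq_neg.mp (hsq i 0) with h | h
      · simp [b, signVector, h]
      · simp [b, signVector, h, neg_eq_self, hx0]
    refine ⟨b, ?_, ?_⟩
    · simp only [Finset.coe_filter, Finset.mem_univ, true_and, Set.mem_ofPred_eq]
      refine ⟨by simp [b], fun i => (signVector_add_eq_zero_iff b i (σ i)).mp ?_⟩
      have h := hodd i
      rw [← hb] at h
      simpa [← mul_add, hx0] using h
    · exact (Projectivization.mk_eq_mk_iff' ℂ _ _ _ _).mpr
        ⟨(x 0)⁻¹, by rw [inv_smul_eq_iff₀ hx0, hb]⟩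
end

section
/- For a bijection β : {0,1,2} → {3,4,5}, let P_β = {v ∈ ℂ^6 : v_i + v_{β(i)} = 0 for all i ∈ {0,1,2}} (one of the six planes of the Segre primal through the double point p = (1,1,1,−1,−1,−1)), and define the sign of β as the sign of the permutation i ↦ β(i) − 3 of {0,1,2}. Then for β ≠ β': dim(P_β ∩ P_{β'}) = 2 if sign(β) ≠ sign(β'), and P_β ∩ P_{β'} = span(p) (so the intersection has dimension 1) if sign(β) = sign(β'). (Thus the six planes split into two sets of three, the planes of one set belonging to one ruling of the rank 4 tangent quadric cone at [p] and the planes of the other set to the other ruling.) -/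
/-- The inclusion `{0,1,2} ↪ {0,…,5}`. -/
def emb3 : Fin 3 → Fin 6 := fun i => ⟨i.1, by have := i.isLt; omega⟩

/-- The bijection `{0,1,2} ≃ {3,4,5}`, `i ↦ i + 3`. -/
def shift3 : Fin 3 → Fin 6 := fun i => ⟨i.1 + 3, by have := i.isLt; omega⟩

/-- The double point `p = (1,1,1,-1,-1,-1)` of the Segre primal. -/
def pSeg : Fin 6 → ℂ := fun i => if (i : ℕ) < 3 then 1 else -1

/-- The vector of the plane attached to `β` with prescribed last three coordinates `y`. -/
def planeVector (β : Equiv.Perm (Fin 3)) (y : Fin 3 → ℂ) : Fin 6 → ℂ :=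
  Fin.append (m := 3) (n := 3) (fun i => -y (β i)) y

lemma planeVector_emb3 (β : Equiv.Perm (Fin 3)) (y : Fin 3 → ℂ) (i : Fin 3) :
    planeVector β y (emb3 i) = -y (β i) :=
  Fin.append_left (m := 3) (n := 3) (fun i => -y (β i)) y i

lemma shift3_eq_natAdd (i : Fin 3) : shift3 i = Fin.natAdd 3 i :=
  Fin.ext (Nat.add_comm _ _)

lemma planeVector_shift3 (β : Equiv.Perm (Fin 3)) (y : Fin 3 → ℂ) (i : Fin 3) :
    planeVector β y (shift3 i) = y i := by
  rw [shift3_eq_natAdd]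
  exact Fin.append_right (m := 3) (n := 3) (fun i => -y (β i)) y i

lemma funext_emb3_shift3 {v w : Fin 6 → ℂ} (h : ∀ i, v (emb3 i) = w (emb3 i))
    (h' : ∀ i, v (shift3 i) = w (shift3 i)) : v = w := by
  funext k
  refine Fin.addCases (m := 3) (n := 3) (motive := fun k => v k = w k) h (fun i => ?_) k
  simpa only [shift3_eq_natAdd] using h' i

lemma pSeg_emb3 (i : Fin 3) : pSeg (emb3 i) = 1 := by
  simp [pSeg, emb3]

lemma pSeg_shift3 (i : Fin 3) : pSeg (shift3 i) = -1 := by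
  simp [pSeg, shift3]

lemma Equiv.Perm.orbit_zero_of_sign_eq_one :
    ∀ τ : Equiv.Perm (Fin 3), τ ≠ 1 → Equiv.Perm.sign τ = 1 →
      ∀ j, j = 0 ∨ j = τ 0 ∨ j = τ (τ 0) := by
  decide

lemma Equiv.Perm.exists_swap_of_sign_ne_one :
    ∀ τ : Equiv.Perm (Fin 3), Equiv.Perm.sign τ ≠ 1 →
      ∃ a c, c ≠ a ∧ τ c = c ∧ ∀ j, j = a ∨ j = τ a ∨ j = c := by
  decide

/-- The intersection of two of the planes is described by the functions on `Fin 3` invariant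
under the quotient of the two permutations. -/
lemma mem_planes_iff (β β' : Equiv.Perm (Fin 3)) (v : Fin 6 → ℂ) :
    ((∀ i, v (emb3 i) + v (shift3 (β i)) = 0) ∧ ∀ i, v (emb3 i) + v (shift3 (β' i)) = 0) ↔
      (∀ i, v (emb3 i) = -v (shift3 (β i))) ∧
        ∀ j, v (shift3 ((β * β'⁻¹) j)) = v (shift3 j) := by
  constructor
  · rintro ⟨h, h'⟩
    refine ⟨fun i => eq_neg_of_add_eq_zero_left (h i), fun j => ?_⟩
    have h₁ := h (β'⁻¹ j)
    have h₂ := h' (β'⁻¹ j)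
    rw [← Equiv.Perm.mul_apply, mul_inv_cancel, Equiv.Perm.one_apply] at h₂
    rw [Equiv.Perm.mul_apply]
    linear_combination h₁ - h₂
  · rintro ⟨h, h'⟩
    refine ⟨fun i => by rw [h i]; ring, fun i => ?_⟩
    have h₁ := h' (β' i)
    rw [← Equiv.Perm.mul_apply, inv_mul_cancel_right] at h₁
    rw [h i, h₁]
    ring

/-- For a bijection `β : {0,1,2} → {3,4,5}` (encoded as a permutation of
`Fin 3`, the actual bijection being `i ↦ β(i) + 3`), let
`P_β = {v : v i + v (β i + 3) = 0, i = 0,1,2}` — one of the six planes of the Segre primal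
through the double point `p = (1,1,1,-1,-1,-1)` — and let the sign of `β` be its sign as a
permutation of `{0,1,2}`. Then for `β ≠ β'`: `dim (P_β ∩ P_{β'}) = 2` if the signs differ,
and `P_β ∩ P_{β'} = span p` if the signs agree. Thus the six planes split into the two
rulings of the rank 4 tangent quadric cone at `[p]`. -/
theorem stmt_12 (β β' : Equiv.Perm (Fin 3)) (hne : β ≠ β')
    (W W' : Submodule ℂ (Fin 6 → ℂ))
    (hW : ∀ v, v ∈ W ↔ ∀ i : Fin 3, v (emb3 i) + v (shift3 (β i)) = 0)
    (hW' : ∀ v, v ∈ W' ↔ ∀ i : Fin 3, v (emb3 i) + v (shift3 (β' i)) = 0) :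
    (Equiv.Perm.sign β ≠ Equiv.Perm.sign β' → Module.finrank ℂ ↥(W ⊓ W') = 2) ∧
    (Equiv.Perm.sign β = Equiv.Perm.sign β' → W ⊓ W' = Submodule.span ℂ {pSeg}) := by
  have hmem : ∀ v, v ∈ W ⊓ W' ↔ _ := fun v =>
    (Submodule.mem_inf.trans (and_congr (hW v) (hW' v))).trans (mem_planes_iff β β' v)
  have hsign : Equiv.Perm.sign (β * β'⁻¹) = 1 ↔ Equiv.Perm.sign β = Equiv.Perm.sign β' := by
    rw [map_mul, map_inv, mul_inv_eq_one]
  have hτ : β * β'⁻¹ ≠ 1 := fun h => hne (mul_inv_eq_one.mp h)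
  generalize β * β'⁻¹ = τ at hmem hsign hτ
  constructor
  · intro h
    obtain ⟨a, c, hca, hc, hcov⟩ :=
      Equiv.Perm.exists_swap_of_sign_ne_one τ (fun h' => h (hsign.mp h'))
    let L : ↥(W ⊓ W') →ₗ[ℂ] ℂ × ℂ :=
      ((LinearMap.proj (shift3 a)).prod (LinearMap.proj (shift3 c))).comp (W ⊓ W').subtype
    have hL : Function.Bijective L := by
      constructor
      · rw [← LinearMap.ker_eq_bot, LinearMap.ker_eq_bot']
        rintro ⟨v, hv⟩ hv0
        obtain ⟨hx, hy⟩ := (hmem v).mp hv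
        have ha0 : v (shift3 a) = 0 := congrArg Prod.fst hv0
        have hc0 : v (shift3 c) = 0 := congrArg Prod.snd hv0
        have hy0 : ∀ j, v (shift3 j) = 0 := by
          intro j
          rcases hcov j with rfl | rfl | rfl
          · exact ha0
          · rw [hy, ha0]
          · exact hc0
        refine Subtype.ext (funext_emb3_shift3 (fun i => ?_) hy0)
        simp [hx, hy0]
      · rintro ⟨s, t⟩
        refine ⟨⟨planeVector β (fun j => if j = c then t else s), (hmem _).mpr ⟨fun i => ?_,
          fun j => ?_⟩⟩, Prod.ext ?_ ?_⟩
        · rw [planeVector_emb3, planeVector_shift3]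
        · rw [planeVector_shift3, planeVector_shift3]
          have : τ j = c ↔ j = c := by
            conv_lhs => rw [← hc]
            exact τ.injective.eq_iff
          simp only [this]
        · exact (planeVector_shift3 β (fun j => if j = c then t else s) a).trans (if_neg hca.symm)
        · exact (planeVector_shift3 β (fun j => if j = c then t else s) c).trans (if_pos rfl)
    rw [(LinearEquiv.ofBijective L hL).finrank_eq, Module.finrank_prod, Module.finrank_self]
  · intro h
    have hcov := Equiv.Perm.orbit_zero_of_sign_eq_one τ hτ (hsign.mpr h)
    ext v
    rw [hmem, Submodule.mem_span_singleton]
    constructor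
    · rintro ⟨hx, hy⟩
      have hconst : ∀ j, v (shift3 j) = v (shift3 0) := by
        intro j
        rcases hcov j with rfl | rfl | rfl <;> simp only [hy]
      refine ⟨-v (shift3 0), funext_emb3_shift3 (fun i => ?_) (fun i => ?_)⟩
      · rw [Pi.smul_apply, pSeg_emb3, hx, hconst (β i), smul_eq_mul, mul_one]
      · rw [Pi.smul_apply, pSeg_shift3, hconst i, smul_eq_mul, neg_mul_neg, mul_one]
    · rintro ⟨r, rfl⟩
      simp [pSeg_emb3, pSeg_shift3]
end
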